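/- arXiv:0806.1210 — 3 statements merged into one kernel-verified Lean document; each statement's English description precedes it below -/
import Mathlib

section
/- Every complete folding sequence has exactly 4t distinct subwords of length t for each integer t ≥ 7, and exactly 2, 4, 8, 12, 18, 23 distinct subwords of length t = 1, 2, 3, 4, 5, 6 respectively. -/
/-- Reversal-with-negation of a finite ±1 word. -/
def negRev (S : List ℤ) : List ℤ := (S.map (fun x => -x)).reverse

/-- `IsFold n S` : `S` is an `n`-folding sequence. -/
inductive IsFold : ℕ → List ℤ → Prop
  | zero : IsFold 0 []
  | succ (n : ℕ) (S : List ℤ) (ε : ℤ) : IsFold n S → (ε = 1 ∨ ε = -1) →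
      IsFold (n + 1) (negRev S ++ ε :: S)

/-- The subword `(a (h+1), …, a (h+t))` of a bi-infinite sequence. -/
def subwordAt (a : ℤ → ℤ) (h : ℤ) (t : ℕ) : List ℤ :=
  (List.range t).map fun i => a (h + 1 + (i : ℤ))

/-- `T` is a finite subword of the bi-infinite sequence `a`. -/
def IsSubword (a : ℤ → ℤ) (T : List ℤ) : Prop := ∃ h : ℤ, T = subwordAt a h T.length

/-- A finite folding sequence: a subword of some `n`-folding sequence. -/
def IsFiniteFold (T : List ℤ) : Prop := ∃ n S, IsFold n S ∧ T <:+: S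

/-- The sequence takes values in `{+1, -1}`. -/
def PM (a : ℤ → ℤ) : Prop := ∀ h : ℤ, a h = 1 ∨ a h = -1

/-- `a (hn + k·2^(n+1)) = (-1)^k · a hn` for all `k`. -/
def AltProp (a : ℤ → ℤ) (n : ℕ) (hn : ℤ) : Prop :=
  ∀ k : ℤ, a (hn + k * 2 ^ (n + 1)) = if Even k then a hn else -a hn

/-- A complete folding sequence (alternation characterization). -/
def CompleteFold (a : ℤ → ℤ) : Prop := PM a ∧ ∀ n : ℕ, ∃ hn : ℤ, AltProp a n hn

/-- Rotate a direction left (`η = 1`) or right (otherwise). -/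
def rot (d : ℤ × ℤ) (η : ℤ) : ℤ × ℤ := if η = 1 then (-d.2, d.1) else (d.2, -d.1)

/-- Unit lattice direction. -/
def IsUnitVec (d : ℤ × ℤ) : Prop := d = (1, 0) ∨ d = (0, 1) ∨ d = (-1, 0) ∨ d = (0, -1)

/-- Direction of the `i`-th step of the curve with turn word `η`. -/
def dirAt (d0 : ℤ × ℤ) (η : List ℤ) (i : ℕ) : ℤ × ℤ := (η.take i).foldl rot d0

/-- `i`-th vertex of the curve started at `X0` with initial direction `d0`. -/
def vertexAt (X0 d0 : ℤ × ℤ) (η : List ℤ) (i : ℕ) : ℤ × ℤ :=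
  X0 + ∑ j ∈ Finset.range i, dirAt d0 η j

/-- `i`-th (unordered) unit edge of the curve. -/
def edgeAt (X0 d0 : ℤ × ℤ) (η : List ℤ) (i : ℕ) : Sym2 (ℤ × ℤ) :=
  s(vertexAt X0 d0 η i, vertexAt X0 d0 η (i + 1))

/-- A complete folding curve, given by its vertex function. -/
def IsCFCurve (V : ℤ → ℤ × ℤ) : Prop :=
  (∀ i : ℤ, IsUnitVec (V (i + 1) - V i)) ∧
  ∃ η : ℤ → ℤ, CompleteFold η ∧ ∀ i : ℤ, V (i + 2) - V (i + 1) = rot (V (i + 1) - V i) (η i)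

/-- Two bi-infinite curves are disjoint: no common unit edge, and at every common
lattice point the four incident traversed edges point in four distinct directions
(the curves do not cross). -/
def CurvesDisjoint (V W : ℤ → ℤ × ℤ) : Prop :=
  (∀ i j : ℤ, s(V i, V (i + 1)) ≠ s(W j, W (j + 1))) ∧
  ∀ i j : ℤ, V i = W j →
    List.Pairwise (· ≠ ·) [V (i - 1) - V i, V (i + 1) - V i, W (j - 1) - W j, W (j + 1) - W j]

/-- The sign `±1` encoded by a Boolean. -/
def boolSign (b : Bool) : ℤ := if b then 1 else -1

/-- The letter at position `y` of the folding pattern whose `i`-th alternating level, carried by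
the `y` of `2`-adic valuation `i`, has phase `l[i]`; positions beyond all levels get `ε`. -/
def patternAt : List Bool → Bool → ℕ → Bool
  | [], ε, _ => ε
  | s :: l, ε, y => if y % 2 = 1 then s ^^ decide (y / 2 % 2 = 1) else patternAt l ε (y / 2)

/-- The binary code of the length-`16` window of a folding pattern starting at `p.1`, with free
letter `p.2`. -/
def windowCode (l : List Bool) (p : ℕ × Bool) : ℕ :=
  Nat.ofBits fun i : Fin 16 => patternAt l p.2 (p.1 + i)

/-- The codes of all windows, over one period, of a folding pattern with four levels. -/
def windowCodes (l : List Bool) : List ℕ :=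
  (List.range 32 ×ˢ [true, false]).map (windowCode l)

/-- The number of distinct elements of a list, not counting those whose bit is set in `m`. -/
def countNew : ℕ → List ℕ → ℕ
  | _, [] => 0
  | m, c :: l => if m.testBit c then countNew m l else countNew (m ||| 2 ^ c) l + 1

lemma countNew_eq_card (m : ℕ) (l : List ℕ) :
    countNew m l = (l.toFinset.filter fun c => ¬ m.testBit c).card := by
  induction l generalizing m with
  | nil => rfl
  | cons c l ih =>
    simp only [countNew, List.toFinset_cons, Finset.filter_insert]
    split_ifs with h
    · exact ih m
    · rw [ih, ← Finset.card_insert_of_notMem (a := c) (by simp)]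
      congr 1
      ext d
      by_cases hd : d = c
      · simp [hd]
      · simp [hd, Nat.testBit_two_pow, Ne.symm hd]

lemma countNew_windowCodes : ∀ s₀ s₁ s₂ s₃ : Bool, ∀ t < 14,
    countNew 0 ((windowCodes [s₀, s₁, s₂, s₃]).map (· % 2 ^ t)) =
      [1, 2, 4, 8, 12, 18, 23, 28, 32, 36, 40, 44, 48, 52].getD t 0 := by
  decide +kernel

lemma windowCode_even_ne_odd : ∀ s₀ s₁ s₂ s₃ ε ε' : Bool, ∀ r < 16, ∀ r' < 16,
    windowCode [s₀, s₁, s₂, s₃] (2 * r, ε) % 2 ^ 7 ≠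
      windowCode [s₀, s₁, s₂, s₃] (2 * r' + 1, ε') % 2 ^ 7 := by
  decide +kernel

lemma CompleteFold.exists_step {a : ℤ → ℤ} (ha : CompleteFold a) :
    ∃ (g : ℤ) (s : Bool), (∀ k : ℤ, a (g + (2 * k + 1)) = boolSign (s ^^ decide (k % 2 = 1))) ∧
      CompleteFold fun k => a (g + 2 * k) := by
  obtain ⟨hpm, halt⟩ := ha
  obtain ⟨h₀, hh₀⟩ := halt 0
  have hodd : ∀ k : ℤ, a (h₀ + 2 * k) = if Even k then a h₀ else -a h₀ := fun k => by
    rw [← hh₀ k]; congr 1; ring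
  refine ⟨h₀ - 1, decide (a h₀ = 1), fun k => ?_, fun k => hpm _, fun n => ?_⟩
  · rw [show h₀ - 1 + (2 * k + 1) = h₀ + 2 * k by ring, hodd]
    rcases Int.emod_two_eq_zero_or_one k with hk | hk <;> rcases hpm h₀ with h | h <;>
      simp [Int.even_iff, boolSign, hk, h]
  · obtain ⟨h₁, hh₁⟩ := halt (n + 1)
    have hpar : (h₁ - h₀) % 2 = 1 := by
      by_contra hne
      obtain ⟨m, hm⟩ : ∃ m, h₁ = h₀ + 2 * m := ⟨(h₁ - h₀) / 2, by omega⟩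
      have h := hh₁ 1
      rw [hm, show h₀ + 2 * m + 1 * 2 ^ (n + 1 + 1) = h₀ + 2 * (m + 2 * 2 ^ n) by ring,
        hodd, hodd] at h
      have := hpm h₀
      simp only [Int.even_add, even_two_mul, iff_true, Int.not_even_one, if_false] at h
      split_ifs at h <;> omega
    obtain ⟨m, hm⟩ : ∃ m, h₁ = h₀ - 1 + 2 * m := ⟨(h₁ - h₀ + 1) / 2, by omega⟩
    refine ⟨m, fun k => ?_⟩
    beta_reduce
    rw [← hm, ← hh₁ k, hm]
    congr 1
    ring

lemma CompleteFold.exists_pattern (n : ℕ) : ∀ {a : ℤ → ℤ}, CompleteFold a →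
    ∃ (g : ℤ) (l : List Bool) (c : ℤ → ℤ), l.length = n ∧ CompleteFold c ∧
      ∀ (q : ℤ) (y : ℕ), a (g + (2 ^ (n + 1) * q + y)) =
        boolSign (patternAt l (decide (c (2 * q + (y / 2 ^ n : ℕ)) = 1)) y) := by
  induction n with
  | zero =>
    intro a ha
    refine ⟨0, [], a, rfl, ha, fun q y => ?_⟩
    rcases ha.1 (2 * q + y) with h | h <;> simp [patternAt, boolSign, h]
  | succ n ih =>
    intro a ha
    obtain ⟨g, s, hs, hb⟩ := ha.exists_step
    obtain ⟨g', l, c, hl, hc, hpat⟩ := ih hb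
    refine ⟨g + 2 * g', (s ^^ decide (g' % 2 = 1)) :: l, c, by simp [hl], hc, fun q y => ?_⟩
    obtain ⟨z, rfl | rfl⟩ := Nat.even_or_odd' y
    · have h := hpat q z
      simp only [patternAt, Nat.mul_mod_right, zero_ne_one, if_false]
      rw [pow_succ' 2 n, Nat.mul_div_mul_left _ _ two_pos, Nat.mul_div_cancel_left _ two_pos, ← h]
      congr 1
      push_cast
      ring
    · have h := hs (g' + (2 ^ (n + 1) * q + z))
      rw [show g + 2 * g' + (2 ^ (n + 1 + 1) * q + ((2 * z + 1 : ℕ) : ℤ)) =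
        g + (2 * (g' + (2 ^ (n + 1) * q + z)) + 1) by push_cast; ring, h]
      have hz : (2 * z + 1) / 2 = z := by omega
      have hmod : (g' + (2 ^ (n + 1) * q + z)) % 2 = (g' + z) % 2 := by
        rw [show g' + (2 ^ (n + 1) * q + z) = g' + z + 2 * (2 ^ n * q) by ring]
        simp
      simp only [patternAt, Nat.mul_add_mod_self_left, hz, hmod, Nat.reduceMod, if_true]
      congr 1
      rcases Int.emod_two_eq_zero_or_one g' with h1 | h1 <;>
        rcases Nat.mod_two_eq_zero_or_one z with h2 | h2 <;> cases s <;>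
        simp [Int.add_emod, h1, h2] <;> omega

lemma patternAt_congr {l : List Bool} {y : ℕ} (ε ε' : Bool) (hy : ¬ 2 ^ l.length ∣ y) :
    patternAt l ε y = patternAt l ε' y := by
  induction l generalizing y with
  | nil => simp at hy
  | cons s l ih =>
    simp only [patternAt]
    split_ifs with h
    · rfl
    · refine ih fun hd => hy ?_
      rw [List.length_cons, pow_succ', show y = 2 * (y / 2) by omega]
      exact mul_dvd_mul_left 2 hd

lemma CompleteFold.exists_eq {a : ℤ → ℤ} (ha : CompleteFold a) (ε : Bool) (i : ℤ) :
    ∃ q : ℤ, decide (a (2 * q + i) = 1) = ε := by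
  obtain ⟨g, s, hs, hb⟩ := ha.exists_step
  by_cases hpar : (g - i) % 2 = 1
  · have key : ∀ m, a (2 * ((g - i) / 2 + 1 + m) + i) = boolSign (s ^^ decide (m % 2 = 1)) :=
      fun m => by rw [← hs]; congr 1; omega
    by_cases hε : s = ε
    · exact ⟨(g - i) / 2 + 1 + 0, by rw [key]; subst hε; cases s <;> simp [boolSign]⟩
    · exact ⟨(g - i) / 2 + 1 + 1, by
        rw [key]; revert hε; cases s <;> cases ε <;> simp [boolSign]⟩
  · obtain ⟨g', s', hs', -⟩ := hb.exists_step
    have key : ∀ m, a (2 * ((g - i) / 2 + g' + 1 + 2 * m) + i) =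
        boolSign (s' ^^ decide (m % 2 = 1)) := fun m => by
      rw [← hs']; congr 1; omega
    by_cases hε : s' = ε
    · exact ⟨(g - i) / 2 + g' + 1 + 2 * 0, by rw [key]; subst hε; cases s' <;> simp [boolSign]⟩
    · exact ⟨(g - i) / 2 + g' + 1 + 2 * 1, by
        rw [key]; revert hε; cases s' <;> cases ε <;> simp [boolSign]⟩

lemma subwordAt_eq_map (a : ℤ → ℤ) (h : ℤ) (t : ℕ) :
    subwordAt a h t = (List.range t).map fun i : ℕ => a (h + 1 + i) := by
  simp only [subwordAt, bind_pure_comp, List.map_eq_map, List.map_map, Function.comp_def]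

lemma subwordAt_eq_iff {a : ℤ → ℤ} {h h' : ℤ} {t : ℕ} :
    subwordAt a h t = subwordAt a h' t ↔ ∀ i : ℕ, i < t → a (h + 1 + i) = a (h' + 1 + i) := by
  simp only [subwordAt_eq_map, List.map_inj_left, List.mem_range]

/-- The `±1` word of length `t` with binary code `N`. -/
def codeWord (t N : ℕ) : List ℤ := (List.range t).map fun i => boolSign (N.testBit i)

lemma codeWord_eq_iff {t N M : ℕ} :
    codeWord t N = codeWord t M ↔ N % 2 ^ t = M % 2 ^ t := by
  have hinj : ∀ b b' : Bool, boolSign b = boolSign b' ↔ b = b' := by decide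
  simp only [codeWord, List.map_inj_left, List.mem_range, hinj]
  refine ⟨fun h => Nat.eq_of_testBit_eq fun i => ?_, fun h i hi => ?_⟩
  · by_cases hi : i < t <;> simp [Nat.testBit_mod_two_pow, hi, h]
  · simpa [Nat.testBit_mod_two_pow, hi] using congrArg (Nat.testBit · i) h

lemma CompleteFold.exists_windowCode {a : ℤ → ℤ} (ha : CompleteFold a) :
    ∃ (g : ℤ) (s₀ s₁ s₂ s₃ : Bool),
      (∀ h, ∃ ε, ∀ t ≤ 16, subwordAt a h t =
        codeWord t (windowCode [s₀, s₁, s₂, s₃] (((h - g) % 32).toNat, ε))) ∧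
      ∀ r < 32, ∀ ε, ∃ h, ∀ t ≤ 16, subwordAt a h t =
        codeWord t (windowCode [s₀, s₁, s₂, s₃] (r, ε)) := by
  obtain ⟨g, l, c, hl, hc, hpat⟩ := ha.exists_pattern 4
  obtain ⟨s₀, s₁, s₂, s₃, rfl⟩ := List.length_eq_four.1 hl
  have key : ∀ (q : ℤ) (r t : ℕ), t ≤ 16 → subwordAt a (g - 1 + (32 * q + r)) t =
      codeWord t (windowCode [s₀, s₁, s₂, s₃]
        (r, decide (c (2 * q + ((r + 15) / 16 : ℕ)) = 1))) := fun q r t ht => by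
    rw [subwordAt_eq_map, codeWord, List.map_inj_left]
    intro i hi
    have hi : i < 16 := (List.mem_range.1 hi).trans_le ht
    rw [windowCode, Nat.testBit_ofBits_lt _ _ hi,
      show g - 1 + (32 * q + r) + 1 + (i : ℤ) = g + (2 ^ (4 + 1) * q + (r + i : ℕ)) by
        push_cast; ring, hpat]
    by_cases hd : 16 ∣ r + i
    · rw [show (r + i) / 2 ^ 4 = (r + 15) / 16 by omega]
    · exact congrArg _ (patternAt_congr _ _ hd)
  refine ⟨g - 1, s₀, s₁, s₂, s₃, fun h => ⟨decide (c (2 * ((h - (g - 1)) / 32) +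
    ((((h - (g - 1)) % 32).toNat + 15) / 16 : ℕ)) = 1), fun t ht => ?_⟩, fun r hr ε => ?_⟩
  · rw [← key _ _ t ht]
    congr 1
    omega
  · obtain ⟨q, hq⟩ := hc.exists_eq ε ((r + 15) / 16 : ℕ)
    exact ⟨_, fun t ht => by rw [key q r t ht, hq]⟩

lemma CompleteFold.ncard_subwordAt_of_lt {a : ℤ → ℤ} (ha : CompleteFold a) {t : ℕ} (ht : t < 14) :
    (Set.range fun h : ℤ => subwordAt a h t).ncard =
      [1, 2, 4, 8, 12, 18, 23, 28, 32, 36, 40, 44, 48, 52].getD t 0 := by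
  obtain ⟨g, s₀, s₁, s₂, s₃, h₁, h₂⟩ := ha.exists_windowCode
  rw [← countNew_windowCodes s₀ s₁ s₂ s₃ t ht, countNew_eq_card,
    Finset.filter_true_of_mem (by simp), ← Set.ncard_coe_finset]
  have himage : (Set.range fun h : ℤ => subwordAt a h t) = codeWord t ''
      ((windowCodes [s₀, s₁, s₂, s₃]).map (· % 2 ^ t)).toFinset := by
    ext w
    have hmod : ∀ N, codeWord t (N % 2 ^ t) = codeWord t N := fun N =>
      codeWord_eq_iff.2 (Nat.mod_mod _ _)
    simp only [Set.mem_range, Set.mem_image, List.coe_toFinset, List.mem_map, windowCodes,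
      Set.mem_ofPred_eq, exists_exists_and_eq_and, hmod]
    constructor
    · rintro ⟨h, rfl⟩
      obtain ⟨ε, hε⟩ := h₁ h
      refine ⟨(((h - g) % 32).toNat, ε), ?_, (hε t (by omega)).symm⟩
      refine List.pair_mem_product.2 ⟨List.mem_range.2 (by omega), ?_⟩
      cases ε <;> simp
    · rintro ⟨⟨r, ε⟩, hp, rfl⟩
      obtain ⟨h, hh⟩ := h₂ r (List.mem_range.1 (List.pair_mem_product.1 hp).1) ε
      exact ⟨h, hh t (by omega)⟩
  rw [himage]
  refine Set.InjOn.ncard_image fun x hx y hy hxy => ?_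
  simp only [List.coe_toFinset, List.mem_map, Set.mem_ofPred_eq] at hx hy
  obtain ⟨x, -, rfl⟩ := hx
  obtain ⟨y, -, rfl⟩ := hy
  simpa using codeWord_eq_iff.1 hxy

lemma CompleteFold.emod_two_eq {a : ℤ → ℤ} (ha : CompleteFold a) {t : ℕ} (ht : 7 ≤ t) {h h' : ℤ}
    (heq : subwordAt a h t = subwordAt a h' t) : h % 2 = h' % 2 := by
  obtain ⟨g, s₀, s₁, s₂, s₃, h₁, -⟩ := ha.exists_windowCode
  obtain ⟨ε, hε⟩ := h₁ h
  obtain ⟨ε', hε'⟩ := h₁ h'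
  have h7 : subwordAt a h 7 = subwordAt a h' 7 :=
    subwordAt_eq_iff.2 fun i hi => subwordAt_eq_iff.1 heq i (hi.trans_le ht)
  rw [hε 7 (by norm_num), hε' 7 (by norm_num), codeWord_eq_iff] at h7
  obtain ⟨r, hr | hr⟩ := Nat.even_or_odd' ((h - g) % 32).toNat <;>
    obtain ⟨r', hr' | hr'⟩ := Nat.even_or_odd' ((h' - g) % 32).toNat
  · omega
  · rw [hr, hr'] at h7
    exact absurd h7 (windowCode_even_ne_odd _ _ _ _ _ _ _ (by omega) _ (by omega))
  · rw [hr, hr'] at h7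
    exact absurd h7.symm (windowCode_even_ne_odd _ _ _ _ _ _ _ (by omega) _ (by omega))
  · omega

lemma ncard_range_eq_of_eq_iff {α β γ : Type*} {f : α → β} {f' : α → γ}
    (h : ∀ x y, f x = f y ↔ f' x = f' y) : (Set.range f).ncard = (Set.range f').ncard := by
  refine Nat.card_congr ((Setoid.quotientKerEquivRange f).symm.trans
    ((Quotient.congr (Equiv.refl α) fun x y => ?_).trans (Setoid.quotientKerEquivRange f')))
  exact h x y

lemma CompleteFold.ncard_subwordAt {a : ℤ → ℤ} (ha : CompleteFold a) {t : ℕ} (ht : 7 ≤ t) :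
    (Set.range fun h : ℤ => subwordAt a h t).ncard = 4 * t := by
  induction t using Nat.strong_induction_on generalizing a with
  | _ t ih =>
  by_cases hlt : t < 14
  · rw [ha.ncard_subwordAt_of_lt hlt]
    interval_cases t <;> rfl
  obtain ⟨g, s, hs, hb⟩ := ha.exists_step
  set b : ℤ → ℤ := fun k => a (g + 2 * k)
  have hsplit : (Set.range fun h : ℤ => subwordAt a h t) =
      (Set.range fun k : ℤ => subwordAt a (g + 2 * k + 1) t) ∪
        Set.range fun k : ℤ => subwordAt a (g + 2 * k) t := by
    ext w
    simp only [Set.mem_range, Set.mem_union]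
    constructor
    · rintro ⟨h, rfl⟩
      rcases Int.emod_two_eq_zero_or_one (h - g) with hh | hh
      · exact .inr ⟨(h - g) / 2, by congr 1; omega⟩
      · exact .inl ⟨(h - g) / 2, by congr 1; omega⟩
    · rintro (⟨k, rfl⟩ | ⟨k, rfl⟩) <;> exact ⟨_, rfl⟩
  have hdisj : Disjoint (Set.range fun k : ℤ => subwordAt a (g + 2 * k + 1) t)
      (Set.range fun k : ℤ => subwordAt a (g + 2 * k) t) := by
    rw [Set.disjoint_left]
    rintro _ ⟨k, rfl⟩ ⟨k', hk⟩
    have := ha.emod_two_eq ht hk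
    omega
  have hodd : (Set.range fun k : ℤ => subwordAt a (g + 2 * k + 1) t).ncard =
      4 * ((t + 1) / 2) := by
    rw [← ih ((t + 1) / 2) (by omega) hb (by omega)]
    refine ncard_range_eq_of_eq_iff fun k k' => ⟨fun h => ?_, fun h => ?_⟩
    · refine subwordAt_eq_iff.2 fun i hi => ?_
      have := subwordAt_eq_iff.1 h (2 * i) (by omega)
      convert this using 2 <;> push_cast <;> ring
    · have hpar := hb.emod_two_eq (by omega) h
      refine subwordAt_eq_iff.2 fun i hi => ?_
      obtain ⟨j, rfl | rfl⟩ := Nat.even_or_odd' i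
      · have := subwordAt_eq_iff.1 h j (by omega)
        convert this using 2 <;> push_cast <;> ring
      · have h1 := hs (k + 1 + j)
        have h2 := hs (k' + 1 + j)
        rw [show (k' + 1 + j) % 2 = (k + 1 + j) % 2 by omega, ← h1] at h2
        convert h2.symm using 2 <;> push_cast <;> ring
  have heven : (Set.range fun k : ℤ => subwordAt a (g + 2 * k) t).ncard = 4 * (t / 2) := by
    rw [← ih (t / 2) (by omega) hb (by omega)]
    refine ncard_range_eq_of_eq_iff fun k k' => ⟨fun h => ?_, fun h => ?_⟩
    · refine subwordAt_eq_iff.2 fun i hi => ?_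
      have := subwordAt_eq_iff.1 h (2 * i + 1) (by omega)
      convert this using 2 <;> push_cast <;> ring
    · have hpar := hb.emod_two_eq (by omega) h
      refine subwordAt_eq_iff.2 fun i hi => ?_
      obtain ⟨j, rfl | rfl⟩ := Nat.even_or_odd' i
      · have h1 := hs (k + j)
        have h2 := hs (k' + j)
        rw [show (k' + j) % 2 = (k + j : ℤ) % 2 by omega, ← h1] at h2
        convert h2.symm using 2 <;> push_cast <;> ring
      · have := subwordAt_eq_iff.1 h j (by omega)
        convert this using 2 <;> push_cast <;> ring
  rw [hsplit, Set.ncard_union_eq hdisj (Set.finite_of_ncard_ne_zero (by omega))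
    (Set.finite_of_ncard_ne_zero (by omega)), hodd, heven]
  omega

theorem statement10 (a : ℤ → ℤ) (ha : CompleteFold a) :
    (∀ t : ℕ, 7 ≤ t → Set.ncard (Set.range fun h : ℤ => subwordAt a h t) = 4 * t) ∧
    Set.ncard (Set.range fun h : ℤ => subwordAt a h 1) = 2 ∧
    Set.ncard (Set.range fun h : ℤ => subwordAt a h 2) = 4 ∧
    Set.ncard (Set.range fun h : ℤ => subwordAt a h 3) = 8 ∧
    Set.ncard (Set.range fun h : ℤ => subwordAt a h 4) = 12 ∧
    Set.ncard (Set.range fun h : ℤ => subwordAt a h 5) = 18 ∧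
    Set.ncard (Set.range fun h : ℤ => subwordAt a h 6) = 23 :=
  ⟨fun _ ht => ha.ncard_subwordAt ht, ha.ncard_subwordAt_of_lt (by norm_num),
    ha.ncard_subwordAt_of_lt (by norm_num), ha.ncard_subwordAt_of_lt (by norm_num),
    ha.ncard_subwordAt_of_lt (by norm_num), ha.ncard_subwordAt_of_lt (by norm_num),
    ha.ncard_subwordAt_of_lt (by norm_num)⟩
end

section
/- Every n-folding curve with n = 2k + 7 (k ∈ ℕ) covers a diamond of radius 2^k + 1: there exists a lattice point X such that every unit edge of ℤ² contained in the set {(u,v) : |u − x| + |v − y| ≤ 2^k + 1} (where X = (x,y)) is traversed by the curve. In particular, n-folding curves contain coverings of squares of side length growing exponentially in n. -/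
/-- `Trav X d η e`: the curve from `X` with initial direction `d` and turn word `η` traverses `e`. -/
def Trav : ℤ × ℤ → ℤ × ℤ → List ℤ → Sym2 (ℤ × ℤ) → Prop
  | X, d, [], e => e = s(X, X + d)
  | X, d, a :: η, e => e = s(X, X + d) ∨ Trav (X + d) (rot d a) η e

theorem edgeAt_zero (X d : ℤ × ℤ) (η : List ℤ) : edgeAt X d η 0 = s(X, X + d) := by
  simp [edgeAt, vertexAt, dirAt]

theorem vertexAt_cons (X d : ℤ × ℤ) (a : ℤ) (η : List ℤ) (i : ℕ) :
    vertexAt X d (a :: η) (i + 1) = vertexAt (X + d) (rot d a) η i := by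
  simp [vertexAt, Finset.sum_range_succ', dirAt]
  abel

theorem Trav.exists_edgeAt {X d : ℤ × ℤ} {η : List ℤ} {e : Sym2 (ℤ × ℤ)}
    (h : Trav X d η e) : ∃ i ≤ η.length, edgeAt X d η i = e := by
  induction η generalizing X d with
  | nil => exact ⟨0, le_rfl, (edgeAt_zero X d []).trans (Eq.symm h)⟩
  | cons a η ih =>
    rcases h with h | h
    · exact ⟨0, Nat.zero_le _, (edgeAt_zero X d _).trans h.symm⟩
    · obtain ⟨i, hi, he⟩ := ih h
      refine ⟨i + 1, by simpa using hi, ?_⟩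
      rw [← he, edgeAt, vertexAt_cons, vertexAt_cons, edgeAt]

/-- Interleave the alternating word `σ, -σ, σ, …` with `S`. -/
def interleave : ℤ → List ℤ → List ℤ
  | σ, [] => [σ]
  | σ, a :: S => σ :: a :: interleave (-σ) S

theorem negRev_cons (a : ℤ) (S : List ℤ) : negRev (a :: S) = negRev S ++ [-a] := by
  simp [negRev]

theorem interleave_append_cons (σ ε : ℤ) (A S : List ℤ) :
    interleave σ (A ++ ε :: S) =
      interleave σ A ++ ε :: interleave ((-1) ^ (A.length + 1) * σ) S := by
  induction A generalizing σ with
  | nil => simp [interleave]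
  | cons a A ih => simp [interleave, ih, pow_succ]

theorem negRev_interleave (σ : ℤ) (S : List ℤ) :
    negRev (interleave σ S) = interleave ((-1) ^ (S.length + 1) * σ) (negRev S) := by
  induction S generalizing σ with
  | nil => simp [interleave, negRev]
  | cons a S ih =>
    rw [negRev_cons, interleave_append_cons]
    simp only [interleave, negRev_cons, ih]
    have h : (-1 : ℤ) ^ S.length * (-1) ^ S.length = 1 := by
      rw [← mul_pow]; simp
    simp [negRev, pow_succ]
    linear_combination (-σ) * h

theorem IsFold.exists_interleave {n : ℕ} {T : List ℤ} (h : IsFold (n + 1) T) :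
    ∃ σ S, (σ = 1 ∨ σ = -1) ∧ IsFold n S ∧ T = interleave σ S := by
  induction n generalizing T with
  | zero =>
    rcases h with _ | ⟨_, S, ε, hS, hε⟩
    cases hS
    exact ⟨ε, [], hε, .zero, rfl⟩
  | succ n ih =>
    rcases h with _ | ⟨_, S, ε, hS, hε⟩
    obtain ⟨σ, S', hσ, hS', rfl⟩ := ih hS
    refine ⟨(-1) ^ (S'.length + 1) * σ, _, ?_, .succ n S' ε hS' hε, ?_⟩
    · rcases neg_one_pow_eq_or ℤ (S'.length + 1) with h | h <;> rcases hσ with rfl | rfl <;> simp [h]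
    · have h : (-1 : ℤ) ^ S'.length * (-1) ^ S'.length = 1 := by
        rw [← mul_pow]; simp
      rw [negRev_interleave, interleave_append_cons, ← mul_assoc]
      simp [negRev, pow_succ, h]

/-- The similarity `P ↦ X + (1 + i ^ σ) P` carrying a curve to the even vertices of its unfolding. -/
def expand (X : ℤ × ℤ) (σ : ℤ) (P : ℤ × ℤ) : ℤ × ℤ := X + P + rot P σ

theorem IsUnitVec.rot {w : ℤ × ℤ} (hw : IsUnitVec w) (a : ℤ) : IsUnitVec (rot w a) := by
  simp only [_root_.rot]
  split_ifs <;> rcases hw with rfl | rfl | rfl | rfl <;> simp [IsUnitVec]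

theorem IsUnitVec.even_add_iff {w : ℤ × ℤ} (hw : IsUnitVec w) (P : ℤ × ℤ) :
    Even ((P + w).1 + (P + w).2) ↔ ¬ Even (P.1 + P.2) := by
  simp only [Prod.fst_add, Prod.snd_add, Int.even_iff]
  rcases hw with rfl | rfl | rfl | rfl <;> dsimp only <;> omega

theorem rot_rot_neg {σ : ℤ} (hσ : σ = 1 ∨ σ = -1) (w : ℤ × ℤ) : rot (rot w σ) (-σ) = w := by
  rcases hσ with rfl | rfl <;> simp [rot]

theorem rot_comm (w : ℤ × ℤ) (a b : ℤ) : rot (rot w a) b = rot (rot w b) a := by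
  simp only [rot]
  split_ifs <;> simp

theorem expand_add (X : ℤ × ℤ) (σ : ℤ) (P w : ℤ × ℤ) :
    expand X σ (P + w) = expand X σ P + w + rot w σ := by
  simp only [expand, rot]
  split_ifs <;> simp [Prod.ext_iff] <;> constructor <;> ring

theorem expand_zero (X : ℤ × ℤ) (σ : ℤ) : expand X σ 0 = X := by
  simp only [expand, rot]
  split_ifs <;> simp [Prod.ext_iff]

theorem abs_add_abs_le_iff (a b r : ℤ) :
    |a| + |b| ≤ r ↔ a + b ≤ r ∧ a - b ≤ r ∧ -a + b ≤ r ∧ -a - b ≤ r := by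
  rcases abs_cases a with h | h <;> rcases abs_cases b with h' | h' <;> omega

theorem Trav.interleave_of_even {σ : ℤ} (hσ : σ = 1 ∨ σ = -1) (X : ℤ × ℤ) {S : List ℤ}
    {P w A B : ℤ × ℤ} (hw : IsUnitVec w) (hA : Even (A.1 + A.2)) (h : Trav P w S s(A, B)) :
    (Even (P.1 + P.2) →
      Trav (expand X σ P) w (interleave σ S) s(expand X σ A, expand X σ A + (B - A)) ∧
      Trav (expand X σ P) w (interleave σ S) s(expand X σ A + (B - A), expand X σ B)) ∧
    (¬ Even (P.1 + P.2) →
      Trav (expand X σ P) (rot w σ) (interleave (-σ) S)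
        s(expand X σ A, expand X σ A + (B - A)) ∧
      Trav (expand X σ P) (rot w σ) (interleave (-σ) S)
        s(expand X σ A + (B - A), expand X σ B)) := by
  induction S generalizing P w with
  | nil =>
    simp only [interleave, Trav, rot_rot_neg hσ, add_right_comm _ (rot w σ) w, ← expand_add]
    rcases Sym2.eq_iff.1 h with ⟨rfl, rfl⟩ | ⟨rfl, rfl⟩
    · exact ⟨fun _ => by simp, fun h => absurd hA h⟩
    · refine ⟨fun h => absurd h ((hw.even_add_iff _).1 hA), fun _ => ?_⟩
      have h : expand X σ (B + w) + (B - (B + w)) = expand X σ B + rot w σ := by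
        rw [expand_add]; abel
      rw [h]
      exact ⟨.inr Sym2.eq_swap, .inl Sym2.eq_swap⟩
  | cons a S ih =>
    simp only [interleave, Trav, neg_neg, rot_rot_neg hσ, add_right_comm _ (rot w σ) w,
      ← expand_add]
    rcases h with h | h
    · rcases Sym2.eq_iff.1 h with ⟨rfl, rfl⟩ | ⟨rfl, rfl⟩
      · exact ⟨fun _ => by simp, fun h => absurd hA h⟩
      · refine ⟨fun h => absurd h ((hw.even_add_iff _).1 hA), fun _ => ?_⟩
        have h : expand X σ (B + w) + (B - (B + w)) = expand X σ B + rot w σ := by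
          rw [expand_add]; abel
        rw [h]
        exact ⟨.inr (.inl Sym2.eq_swap), .inl Sym2.eq_swap⟩
    · obtain ⟨h1, h2⟩ := ih (hw.rot a) h
      rw [hw.even_add_iff] at h1 h2
      rw [rot_comm w σ a]
      exact ⟨fun hP => ⟨.inr (.inr (h2 (not_not.2 hP)).1), .inr (.inr (h2 (not_not.2 hP)).2)⟩,
        fun hP => ⟨.inr (.inr (h1 hP).1), .inr (.inr (h1 hP).2)⟩⟩

theorem Trav.expand_even {σ : ℤ} (hσ : σ = 1 ∨ σ = -1) (X : ℤ × ℤ) {S : List ℤ}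
    {w P d : ℤ × ℤ} (hw : IsUnitVec w) (hP : Even (P.1 + P.2)) (h : Trav 0 w S s(P, P + d)) :
    Trav X w (interleave σ S) s(expand X σ P, expand X σ P + d) := by
  have := ((h.interleave_of_even hσ X hw hP).1 (by simp)).1
  rwa [expand_zero, add_sub_cancel_left] at this

theorem Trav.expand_odd {σ : ℤ} (hσ : σ = 1 ∨ σ = -1) (X : ℤ × ℤ) {S : List ℤ}
    {w P d : ℤ × ℤ} (hw : IsUnitVec w) (hd : IsUnitVec d) (hP : ¬ Even (P.1 + P.2))
    (h : Trav 0 w S s(P, P + rot d (-σ))) :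
    Trav X w (interleave σ S) s(expand X σ P, expand X σ P + d) := by
  rw [Sym2.eq_swap] at h
  have := ((h.interleave_of_even hσ X hw (((hd.rot _).even_add_iff P).2 hP)).1 (by simp)).2
  rw [expand_add, rot_comm, rot_rot_neg hσ, Sym2.eq_swap] at this
  rw [expand_zero] at this
  convert this using 2
  simp; abel_nf

theorem exists_expand_eq {σ : ℤ} (hσ : σ = 1 ∨ σ = -1) {X u : ℤ × ℤ}
    (hu : Even ((u - X).1 + (u - X).2)) : ∃ P, u = expand X σ P := by
  obtain ⟨m, hm⟩ := hu
  rcases hσ with rfl | rfl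
  · refine ⟨(m, m - (u - X).1), ?_⟩
    simp only [expand, rot, Prod.ext_iff, Prod.fst_sub, Prod.snd_sub] at *
    simp
    omega
  · refine ⟨(m - (u - X).2, m), ?_⟩
    simp only [expand, rot, Prod.ext_iff, Prod.fst_sub, Prod.snd_sub] at *
    simp
    omega

/-- Every edge of the diamond of radius `r` centred at `c` satisfies `E`. -/
def CoversDiamond (E : Sym2 (ℤ × ℤ) → Prop) (c : ℤ × ℤ) (r : ℤ) : Prop :=
  ∀ u d : ℤ × ℤ, IsUnitVec d → |u.1 - c.1| + |u.2 - c.2| ≤ r →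
    |(u + d).1 - c.1| + |(u + d).2 - c.2| ≤ r → E s(u, u + d)

set_option maxHeartbeats 1000000 in
theorem CoversDiamond.interleave {σ τ : ℤ} (hσ : σ = 1 ∨ σ = -1) (hτ : τ = 1 ∨ τ = -1)
    (X : ℤ × ℤ) {S : List ℤ} {w c : ℤ × ℤ} {r : ℤ} (hw : IsUnitVec w)
    (h : CoversDiamond (Trav 0 w S) c r) :
    CoversDiamond (Trav X w (interleave σ (interleave τ S)))
      (expand X σ (expand 0 τ c)) (2 * r - 1) := by
  suffices H : ∀ u d : ℤ × ℤ, IsUnitVec d → Even ((u - X).1 + (u - X).2) →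
      |u.1 - (expand X σ (expand 0 τ c)).1| + |u.2 - (expand X σ (expand 0 τ c)).2| ≤ 2 * r - 1 →
      Trav X w (_root_.interleave σ (_root_.interleave τ S)) s(u, u + d) by
    intro u d hd hu hv
    by_cases he : Even ((u - X).1 + (u - X).2)
    · exact H u d hd he hu
    · have hd' : IsUnitVec (-d) := by
        rcases hd with rfl | rfl | rfl | rfl <;> simp [IsUnitVec]
      have := H (u + d) (-d) hd' (by rwa [add_sub_right_comm, hd.even_add_iff]) hv
      rwa [add_neg_cancel_right, Sym2.eq_swap] at this
  intro u d hd he hu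
  rw [abs_add_abs_le_iff] at hu
  obtain ⟨Q, rfl⟩ := exists_expand_eq hσ he
  by_cases hQ : Even (Q.1 + Q.2)
  · refine Trav.expand_even hσ X hw hQ ?_
    obtain ⟨P, rfl⟩ := exists_expand_eq (X := 0) hτ (by simpa using hQ)
    by_cases hP : Even (P.1 + P.2)
    · refine Trav.expand_even hτ 0 hw hP (h _ _ hd ?_ ?_) <;> rw [abs_add_abs_le_iff] <;> clear hP hQ he h hw <;>
      rcases hσ with rfl | rfl <;> rcases hτ with rfl | rfl <;>
      rcases hd with rfl | rfl | rfl | rfl <;> simp [expand, rot] at hu ⊢ <;> omega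
    · refine Trav.expand_odd hτ 0 hw hd hP (h _ _ (hd.rot _) ?_ ?_) <;> rw [abs_add_abs_le_iff] <;> clear hP hQ he h hw <;>
      rcases hσ with rfl | rfl <;> rcases hτ with rfl | rfl <;>
      rcases hd with rfl | rfl | rfl | rfl <;> simp [expand, rot] at hu ⊢ <;> omega
  · refine Trav.expand_odd hσ X hw hd hQ ?_
    have hd' := hd.rot (-σ)
    have hd'' : IsUnitVec (-rot d (-σ)) := by
      rcases hd' with h | h | h | h <;> simp [IsUnitVec, h]
    have hQ' := (hd'.even_add_iff Q).2 hQ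
    obtain ⟨P, hP'⟩ := exists_expand_eq (X := 0) hτ (u := Q + rot d (-σ)) (by simpa using hQ')
    obtain rfl : Q = expand 0 τ P - rot d (-σ) := eq_sub_of_add_eq hP'
    rw [sub_add_cancel, Sym2.eq_swap, sub_eq_add_neg]
    by_cases hP : Even (P.1 + P.2)
    · refine Trav.expand_even hτ 0 hw hP (h _ _ hd'' ?_ ?_) <;> rw [abs_add_abs_le_iff] <;>
      clear hP hQ he h hw hd' hd'' hQ' hP' <;>
      rcases hσ with rfl | rfl <;> rcases hτ with rfl | rfl <;>
      rcases hd with rfl | rfl | rfl | rfl <;> simp [expand, rot] at hu ⊢ <;> omega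
    · refine Trav.expand_odd hτ 0 hw hd'' hP (h _ _ (hd''.rot _) ?_ ?_) <;> rw [abs_add_abs_le_iff] <;>
      clear hP hQ he h hw hd' hd'' hQ' hP' <;>
      rcases hσ with rfl | rfl <;> rcases hτ with rfl | rfl <;>
      rcases hd with rfl | rfl | rfl | rfl <;> simp [expand, rot] at hu ⊢ <;> omega

/-- The doubled midpoints of the edges of a curve. -/
def doubledMidpoints : ℤ × ℤ → ℤ × ℤ → List ℤ → List (ℤ × ℤ)
  | X, d, [] => [X + (X + d)]
  | X, d, a :: η => (X + (X + d)) :: doubledMidpoints (X + d) (rot d a) η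

/-- The vertex reached after `i` steps. -/
def walk : ℤ × ℤ → ℤ × ℤ → List ℤ → ℕ → ℤ × ℤ
  | X, _, _, 0 => X
  | X, d, [], _ + 1 => X + d
  | X, d, a :: η, i + 1 => walk (X + d) (rot d a) η i

/-- All `n`-folding words. -/
def folds : ℕ → List (List ℤ)
  | 0 => [[]]
  | n + 1 => (folds n).flatMap fun S => [negRev S ++ 1 :: S, negRev S ++ (-1) :: S]

/-- Doubled midpoints of the edges of the diamond of radius 2 around the origin. -/
def diamondOffsets : List (ℤ × ℤ) :=
  [(-3, 0), (-1, 0), (1, 0), (3, 0), (-1, 2), (1, 2), (-1, -2), (1, -2),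
   (0, -3), (0, -1), (0, 1), (0, 3), (2, -1), (2, 1), (-2, -1), (-2, 1)]

/-- The elements of `L` at `ℓ¹` distance at most 3 from `c`, relative to `c`. -/
def near (c : ℤ × ℤ) (L : List (ℤ × ℤ)) : List (ℤ × ℤ) :=
  (L.map (· - c)).filter fun m => m.1.natAbs + m.2.natAbs ≤ 3

theorem exists_near_of_mem_folds_seven : ∀ S ∈ folds 7, ∃ i ∈ [40, 56, 20, 28],
    ∀ o ∈ diamondOffsets,
      o ∈ near (walk 0 (1, 0) S i + walk 0 (1, 0) S i) (doubledMidpoints 0 (1, 0) S) := by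
  decide +kernel

theorem Trav.of_mem_doubledMidpoints {X w u d : ℤ × ℤ} {S : List ℤ} (hw : IsUnitVec w)
    (hd : IsUnitVec d) (h : u + (u + d) ∈ doubledMidpoints X w S) : Trav X w S s(u, u + d) := by
  have key {X w : ℤ × ℤ} (hw : IsUnitVec w) (h : u + (u + d) = X + (X + w)) :
      s(u, u + d) = s(X, X + w) := by
    rw [Sym2.eq_iff]
    simp only [Prod.ext_iff, Prod.fst_add, Prod.snd_add] at h ⊢
    rcases hd with rfl | rfl | rfl | rfl <;> rcases hw with rfl | rfl | rfl | rfl <;>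
      dsimp only at h ⊢ <;> omega
  induction S generalizing X w with
  | nil => exact key hw (by simpa [doubledMidpoints] using h)
  | cons a S ih =>
    rcases List.mem_cons.1 h with h | h
    · exact .inl (key hw h)
    · exact .inr (ih (hw.rot a) h)

theorem IsFold.mem_folds {n : ℕ} {S : List ℤ} (h : IsFold n S) : S ∈ folds n := by
  induction h with
  | zero => simp [folds]
  | succ n S ε _ hε ih =>
    exact List.mem_flatMap.2 ⟨S, ih, by rcases hε with rfl | rfl <;> simp⟩

theorem Trav.map {f g : ℤ × ℤ → ℤ × ℤ} (hf : ∀ p q, f (p + q) = f p + g q)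
    (hg : ∀ d a, g (rot d a) = rot (g d) a) {X d : ℤ × ℤ} {S : List ℤ} {e : Sym2 (ℤ × ℤ)}
    (h : Trav X d S e) : Trav (f X) (g d) S (e.map f) := by
  have key {X d : ℤ × ℤ} (h : e = s(X, X + d)) : e.map f = s(f X, f X + g d) := by
    rw [h, Sym2.map_mk, hf]
  induction S generalizing X d with
  | nil => exact key h
  | cons a S ih =>
    rcases h with h | h
    · exact .inl (key h)
    · have := ih h
      rw [hf, hg] at this
      exact .inr this

theorem CoversDiamond.rotate {S : List ℤ} {X w c : ℤ × ℤ} {r : ℤ}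
    (h : CoversDiamond (Trav X w S) c r) :
    CoversDiamond (Trav (rot X 1) (rot w 1) S) (rot c 1) r := by
  intro u d hd hu hv
  have := (h (rot u (-1)) (rot d (-1)) (hd.rot _)
    (by rw [abs_add_abs_le_iff] at hu ⊢; simp [rot] at hu ⊢; omega)
    (by rw [abs_add_abs_le_iff] at hv ⊢; simp [rot] at hv ⊢; omega)).map
    (f := (rot · 1)) (g := (rot · 1)) (fun p q => by simp [rot, add_comm])
    (fun d a => rot_comm d a 1)
  have hd' : (u.1 + d.1, u.2 + d.2) = u + d := rfl
  simpa [rot, add_comm, hd'] using this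

theorem CoversDiamond.translate {S : List ℤ} {w c : ℤ × ℤ} {r : ℤ} (X : ℤ × ℤ)
    (h : CoversDiamond (Trav 0 w S) c r) : CoversDiamond (Trav X w S) (X + c) r := by
  intro u d hd hu hv
  have := (h (u - X) d hd
    (by simpa [sub_sub] using hu)
    (by simpa [sub_sub, sub_add_eq_add_sub] using hv)).map
    (f := (X + ·)) (g := id) (fun p q => by simp [add_assoc]) (fun d a => rfl)
  simpa [sub_add_eq_add_sub] using this

theorem diamond_offset_mem {c u d : ℤ × ℤ} (hd : IsUnitVec d)
    (hu : |u.1 - c.1| + |u.2 - c.2| ≤ 2) (hv : |(u + d).1 - c.1| + |(u + d).2 - c.2| ≤ 2) :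
    u + (u + d) - (c + c) ∈ diamondOffsets := by
  obtain ⟨p, rfl⟩ : ∃ p, u = c + p := ⟨u - c, by abel⟩
  obtain ⟨x, y⟩ := p
  rw [abs_add_abs_le_iff] at hu hv
  simp only [Prod.fst_add, Prod.snd_add] at hu hv
  have : c + (x, y) + (c + (x, y) + d) - (c + c) = (x, y) + ((x, y) + d) := by abel
  rw [this]
  have hx : -2 ≤ x ∧ x ≤ 2 := by omega
  have hy : -2 ≤ y ∧ y ≤ 2 := by omega
  obtain ⟨hx1, hx2⟩ := hx
  obtain ⟨hy1, hy2⟩ := hy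
  rcases hd with rfl | rfl | rfl | rfl <;> interval_cases x <;> interval_cases y <;>
    first
    | (exfalso; dsimp only at hu hv; omega)
    | decide

theorem IsFold.exists_coversDiamond_two {S : List ℤ} (hS : IsFold 7 S) {w : ℤ × ℤ}
    (hw : IsUnitVec w) : ∃ c, CoversDiamond (Trav 0 w S) c 2 := by
  obtain ⟨i, -, hi⟩ := exists_near_of_mem_folds_seven S hS.mem_folds
  have h : CoversDiamond (Trav 0 (1, 0) S) (walk 0 (1, 0) S i) 2 := by
    intro u d hd hu hv
    have := hi _ (diamond_offset_mem hd hu hv)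
    obtain ⟨m, hm, he⟩ := List.mem_map.1 (List.mem_filter.1 this).1
    exact .of_mem_doubledMidpoints (.inl rfl) hd (sub_left_injective he ▸ hm)
  rcases hw with rfl | rfl | rfl | rfl
  · exact ⟨_, h⟩
  · exact ⟨_, h.rotate⟩
  · exact ⟨_, h.rotate.rotate⟩
  · exact ⟨_, h.rotate.rotate.rotate⟩

theorem IsFold.exists_coversDiamond (k : ℕ) {S : List ℤ} (hS : IsFold (2 * k + 7) S)
    {w : ℤ × ℤ} (hw : IsUnitVec w) : ∃ c, CoversDiamond (Trav 0 w S) c (2 ^ k + 1) := by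
  induction k generalizing S with
  | zero => exact hS.exists_coversDiamond_two hw
  | succ k ih =>
    obtain ⟨σ, S₁, hσ, hS₁, rfl⟩ := IsFold.exists_interleave (n := 2 * k + 8) hS
    obtain ⟨τ, S₂, hτ, hS₂, rfl⟩ := IsFold.exists_interleave (n := 2 * k + 7) hS₁
    obtain ⟨c, hc⟩ := ih hS₂
    refine ⟨_, (?_ : (2 : ℤ) ^ (k + 1) + 1 = 2 * (2 ^ k + 1) - 1) ▸ hc.interleave hσ hτ 0 hw⟩
    ring

theorem statement18 (k : ℕ) (η : List ℤ) (hη : IsFold (2 * k + 7) η)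
    (X0 d0 : ℤ × ℤ) (hd : IsUnitVec d0) :
    ∃ c : ℤ × ℤ, ∀ u v : ℤ × ℤ,
      (v - u = ((1 : ℤ), (0 : ℤ)) ∨ v - u = ((0 : ℤ), (1 : ℤ))) →
      |u.1 - c.1| + |u.2 - c.2| ≤ 2 ^ k + 1 →
      |v.1 - c.1| + |v.2 - c.2| ≤ 2 ^ k + 1 →
      ∃ i ≤ η.length, edgeAt X0 d0 η i = s(u, v) := by
  obtain ⟨c, hc⟩ := hη.exists_coversDiamond k hd
  refine ⟨X0 + c, fun u v h hu hv => ?_⟩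
  have h' : IsUnitVec (v - u) := h.elim .inl fun h => .inr (.inl h)
  obtain ⟨d, rfl⟩ : ∃ d, v = u + d := ⟨v - u, by abel⟩
  rw [add_sub_cancel_left] at h'
  exact ((hc.translate X0) u _ h' hu hv).exists_edgeAt
end

section
/- At most 24 pairwise disjoint complete folding curves can exist in the plane: if C_1, ..., C_r are complete folding curves in ℤ² that pairwise share no unit edge and pairwise do not cross, then r ≤ 24. -/
lemma IsUnitVec.bounds {d : ℤ × ℤ} (h : IsUnitVec d) :
    d.1 + d.2 ≤ 1 ∧ d.1 - d.2 ≤ 1 ∧ -d.1 + d.2 ≤ 1 ∧ -d.1 - d.2 ≤ 1 := by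
  rcases h with h | h | h | h <;> subst h <;> norm_num

/-- The sum of the endpoints of the `i`-th edge, i.e. twice its midpoint. -/
def edgeSum (V : ℤ → ℤ × ℤ) (i : ℤ) : ℤ × ℤ := V i + V (i + 1)

/-- Multiplication by `1 + i` under the identification of `ℤ × ℤ` with the Gaussian integers. -/
def mulOneAddI (z : ℤ × ℤ) : ℤ × ℤ := (z.1 - z.2, z.1 + z.2)

lemma rot_eq (d : ℤ × ℤ) {e : ℤ} (he : e = 1 ∨ e = -1) : rot d e = (-(e * d.2), e * d.1) := by
  rcases he with rfl | rfl <;> simp [rot]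

lemma coord_sum_emod_two {V : ℤ → ℤ × ℤ} (hV : ∀ i, IsUnitVec (V (i + 1) - V i)) (i : ℤ) :
    ((V i).1 + (V i).2 - (V 0).1 - (V 0).2 - i) % 2 = 0 := by
  have step : ∀ i, ((V (i + 1)).1 + (V (i + 1)).2 - (V i).1 - (V i).2) % 2 = 1 := by
    intro i
    have h := hV i
    simp only [IsUnitVec, Prod.ext_iff, Prod.fst_sub, Prod.snd_sub] at h
    omega
  induction i using Int.induction_on with
  | zero => simp
  | succ n ih => have := step n; omega
  | pred n ih =>
    have := step (-n - 1)
    rw [sub_add_cancel] at this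
    omega

/-- Unfolding a complete folding curve: every second vertex, rescaled by `1 + i`, is again a
complete folding curve, and the omitted vertices lie alternately left and right of its edges. -/
lemma IsCFCurve.exists_unfold {V : ℤ → ℤ × ℤ} (hV : IsCFCurve V) :
    ∃ (W : ℤ → ℤ × ℤ) (c : ℤ) (p : ℤ × ℤ) (P : Prop), IsCFCurve W ∧
      (∀ k, V (c + 2 * k) = p + mulOneAddI (W k)) ∧
      ∀ k, ((Even k ↔ P) ∧ V (c + 2 * k + 1) = V (c + 2 * k) + (W (k + 1) - W k)) ∨
        (¬ (Even k ↔ P) ∧ V (c + 2 * k + 1) = V (c + 2 * k) +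
          (-(W (k + 1) - W k).2, (W (k + 1) - W k).1)) := by
  obtain ⟨hu, η, ⟨hpm, halt⟩, hturn⟩ := hV
  obtain ⟨c, hc⟩ := halt 0
  have hc' : ∀ k, η (c + 2 * k) = if Even k then η c else -η c := by
    intro k
    rw [← hc k]
    ring_nf
  have hpar : ∀ k, ((V (c + 2 * k)).1 + (V (c + 2 * k)).2 - (V c).1 - (V c).2) % 2 = 0 := by
    intro k
    have h1 := coord_sum_emod_two hu (c + 2 * k)
    have h2 := coord_sum_emod_two hu c
    omega
  obtain ⟨W, hWdef⟩ : ∃ W : ℤ → ℤ × ℤ, ∀ k, V (c + 2 * k) = V c + mulOneAddI (W k) := by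
    refine ⟨fun k => (((V (c + 2 * k)).1 - (V c).1 + ((V (c + 2 * k)).2 - (V c).2)) / 2,
      ((V (c + 2 * k)).2 - (V c).2 - ((V (c + 2 * k)).1 - (V c).1)) / 2), fun k => ?_⟩
    have := hpar k
    ext <;> simp only [mulOneAddI, Prod.fst_add, Prod.snd_add] <;> omega
  have hlocal : ∀ k, (η (c + 2 * k) = 1 ∧ V (c + 2 * k + 1) = V (c + 2 * k) + (W (k + 1) - W k)) ∨
      (η (c + 2 * k) = -1 ∧ V (c + 2 * k + 1) = V (c + 2 * k) +
        (-(W (k + 1) - W k).2, (W (k + 1) - W k).1)) := by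
    intro k
    have ht := hturn (c + 2 * k)
    rw [rot_eq _ (hpm _)] at ht
    have h1 := hWdef k
    have h2 := hWdef (k + 1)
    rw [show c + 2 * (k + 1) = c + 2 * k + 2 by ring] at h2
    simp only [Prod.ext_iff, mulOneAddI, Prod.fst_add, Prod.snd_add, Prod.fst_sub,
      Prod.snd_sub] at ht h1 h2 ⊢
    rcases hpm (c + 2 * k) with h | h <;> rw [h] at ht ⊢
    · left; omega
    · right; omega
  refine ⟨W, c, V c, η c = 1, ⟨?_, fun k => η (c + 2 * k + 1), ⟨fun k => hpm _, ?_⟩, ?_⟩, hWdef, ?_⟩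
  · intro k
    have h := hu (c + 2 * k)
    have h' := hlocal k
    simp only [IsUnitVec, Prod.ext_iff, Prod.fst_add, Prod.snd_add, Prod.fst_sub,
      Prod.snd_sub] at h h' ⊢
    omega
  · intro n
    obtain ⟨h, hh⟩ := halt (n + 1)
    have hodd : (h - c) % 2 = 1 := by
      by_contra hne
      obtain ⟨q, hq⟩ : ∃ q, h = c + 2 * q := ⟨(h - c) / 2, by omega⟩
      have h1 := hh 1
      have h2 := hc' q
      have h3 := hc' (q + 2 ^ (n + 1))
      have e1 : c + 2 * (q + 2 ^ (n + 1)) = h + 1 * 2 ^ (n + 1 + 1) := by rw [hq]; ring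
      have e2 : Even (q + 2 ^ (n + 1)) ↔ Even q := by
        rw [Int.even_add]
        simp [Int.even_pow]
      rw [e1, h1] at h3
      simp only [e2] at h3
      rw [← hq] at h2
      rw [← h2] at h3
      have := hpm h
      simp at h3
      omega
    refine ⟨(h - c) / 2, fun k => ?_⟩
    have hq : c + 2 * ((h - c) / 2) + 1 = h := by omega
    have e : c + 2 * ((h - c) / 2 + k * 2 ^ (n + 1)) + 1 = h + k * 2 ^ (n + 1 + 1) := by
      calc _ = (c + 2 * ((h - c) / 2) + 1) + k * 2 ^ (n + 1 + 1) := by ring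
        _ = _ := by rw [hq]
    simp only [e, hq]
    exact hh k
  · intro k
    have ht := hturn (c + 2 * k)
    have ht' := hturn (c + 2 * k + 1)
    have l1 := hlocal k
    have l2 := hlocal (k + 1)
    have hne : η (c + 2 * (k + 1)) = -η (c + 2 * k) := by
      rw [hc', hc']
      by_cases hk : Even k <;> simp [hk]
    rw [hne] at l2
    rw [rot_eq _ (hpm _)] at ht ht' ⊢
    rw [show c + 2 * (k + 1) = c + 2 * k + 2 by ring, show k + 1 + 1 = k + 2 by ring] at l2
    rw [show c + 2 * k + 1 + 2 = c + 2 * k + 2 + 1 by ring,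
      show c + 2 * k + 1 + 1 = c + 2 * k + 2 by ring] at ht'
    simp only [Prod.ext_iff, Prod.fst_add, Prod.snd_add, Prod.fst_sub,
      Prod.snd_sub] at ht ht' l1 l2 ⊢
    rcases hpm (c + 2 * k) with h | h <;> rcases hpm (c + 2 * k + 1) with h' | h' <;>
      rw [h] at ht l1 l2 <;> rw [h'] at ht' ⊢ <;> omega
  · intro k
    have h := hlocal k
    have h2 := hc' k
    rcases hpm c with h0 | h0 <;> by_cases hk : Even k <;> simp_all

/-- How edge midpoints behave under unfolding: each edge is one unit (in doubled coordinates) away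
from the unfolded edge replacing it, and edges at the same place unfold to edges at the same
place. -/
lemma IsCFCurve.exists_edgeSum_unfold {V : ℤ → ℤ × ℤ} (hV : IsCFCurve V) :
    ∃ (W : ℤ → ℤ × ℤ) (c : ℤ) (p : ℤ × ℤ), IsCFCurve W ∧
      (∀ i, IsUnitVec (edgeSum V i - p - mulOneAddI (edgeSum W ((i - c) / 2)))) ∧
      ∀ i j, edgeSum V i = edgeSum V j →
        edgeSum W ((i - c) / 2) = edgeSum W ((j - c) / 2) := by
  obtain ⟨W, c, p, P, hW, hX, hY⟩ := hV.exists_unfold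
  have hX' : ∀ k, V (c + 2 * k + 1 + 1) = p + mulOneAddI (W (k + 1)) := by
    intro k
    rw [← hX]
    ring_nf
  -- `a` is the end of the unfolded edge that lies on the edge `i`, `d` points from it to the other
  -- end.
  have key : ∀ i, ∃ (a : ℤ) (d : ℤ × ℤ), IsUnitVec d ∧
      edgeSum W ((i - c) / 2) = W a + W a + d ∧
      (((Even a ↔ P) ∧
        edgeSum V i = p + p + mulOneAddI (W a + W a) + d) ∨
      (¬ (Even a ↔ P) ∧
        edgeSum V i = p + p + mulOneAddI (W a + W a) + (-d.2, d.1))) := by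
    intro i
    obtain ⟨k, hk, hi⟩ : ∃ k, (i - c) / 2 = k ∧ (i = c + 2 * k ∨ i = c + 2 * k + 1) :=
      ⟨(i - c) / 2, rfl, by omega⟩
    rw [hk]
    have u := hW.1 k
    have x := hX k
    have x' := hX' k
    rcases hi with rfl | rfl
    · refine ⟨k, W (k + 1) - W k, u, ?_, (hY k).imp ?_ ?_⟩
      · simp only [edgeSum]; abel
      all_goals
        refine fun h => ⟨h.1, ?_⟩
        have y := h.2
        simp only [edgeSum, mulOneAddI, Prod.ext_iff, Prod.fst_add, Prod.snd_add,
          Prod.fst_sub, Prod.snd_sub] at *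
        omega
    · refine ⟨k + 1, W k - W (k + 1), ?_, ?_, (hY k).symm.imp ?_ ?_⟩
      · simp only [IsUnitVec, Prod.ext_iff, Prod.fst_sub, Prod.snd_sub] at *
        omega
      · simp only [edgeSum]; abel
      all_goals
        refine fun h => ⟨?_, ?_⟩
        · have := h.1
          rw [Int.even_add_one]
          tauto
        have y := h.2
        simp only [edgeSum, mulOneAddI, Prod.ext_iff, Prod.fst_add, Prod.snd_add,
          Prod.fst_sub, Prod.snd_sub] at *
        omega
  refine ⟨W, c, p + p, hW, fun i => ?_, fun i j hij => ?_⟩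
  · obtain ⟨a, d, hd, h1, ⟨-, h2⟩ | ⟨-, h2⟩⟩ := key i <;> rw [h1, h2] <;>
    simp only [mulOneAddI, IsUnitVec, Prod.ext_iff, Prod.fst_add, Prod.snd_add,
      Prod.fst_sub, Prod.snd_sub] at * <;> omega
  · obtain ⟨a, d, hd, h1, h2⟩ := key i
    obtain ⟨b, e, he, h3, h4⟩ := key j
    rw [hij] at h2
    rw [h1, h3]
    have hab : W a = W b := by
      clear h1 h3
      rcases h2 with ⟨-, h2⟩ | ⟨-, h2⟩ <;> rcases h4 with ⟨-, h4⟩ | ⟨-, h4⟩ <;>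
      rw [h2] at h4 <;>
      simp only [mulOneAddI, IsUnitVec, Prod.ext_iff, Prod.fst_add, Prod.snd_add] at * <;>
      omega
    have hpar : Even a ↔ Even b := by
      have p1 := coord_sum_emod_two hW.1 a
      have p2 := coord_sum_emod_two hW.1 b
      rw [hab] at p1
      rw [Int.even_iff, Int.even_iff]
      omega
    rw [hab, hpar] at h2
    rw [hab]
    congr 1
    rcases h2 with ⟨q, h2⟩ | ⟨q, h2⟩ <;> rcases h4 with ⟨q', h4⟩ | ⟨q', h4⟩
    · exact add_left_cancel (h2.symm.trans h4)
    · exact absurd q q'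
    · exact absurd q' q
    · have := add_left_cancel (h2.symm.trans h4)
      simp only [Prod.ext_iff] at this ⊢
      omega

lemma IsCFCurve.abs_edgeSum_sub_le (n : ℕ) {V : ℤ → ℤ × ℤ} (hV : IsCFCurve V) {i j : ℤ}
    (h1 : i - j ≤ 2 * 4 ^ n) (h2 : j - i ≤ 2 * 4 ^ n) :
    |(edgeSum V i).1 - (edgeSum V j).1| ≤ 6 * 2 ^ n - 4 ∧
      |(edgeSum V i).2 - (edgeSum V j).2| ≤ 6 * 2 ^ n - 4 := by
  induction n generalizing V i j with
  | zero =>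
    wlog hij : i ≤ j generalizing i j
    · have := this h2 h1 (by omega)
      rwa [abs_sub_comm, abs_sub_comm (edgeSum V i).2]
    have b : ∀ k, |(edgeSum V (k + 1)).1 - (edgeSum V k).1| ≤ 1 ∧
        |(edgeSum V (k + 1)).2 - (edgeSum V k).2| ≤ 1 := by
      intro k
      obtain ⟨hu, η, ⟨hpm, -⟩, hturn⟩ := hV
      have u := hu k
      have t := hturn k
      rw [rot_eq _ (hpm _)] at t
      rw [abs_le, abs_le]
      simp only [edgeSum, add_assoc, Int.reduceAdd]
      simp only [IsUnitVec, Prod.ext_iff, Prod.fst_add, Prod.snd_add, Prod.fst_sub,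
        Prod.snd_sub] at *
      rcases hpm k with h | h <;> rw [h] at t <;> omega
    have b1 := b i
    have b2 := b (i + 1)
    rw [add_assoc] at b2
    norm_num at h1 h2 b2 ⊢
    obtain rfl | rfl | rfl : j = i ∨ j = i + 1 ∨ j = i + 2 := by omega
    · simp
    all_goals simp only [abs_le] at *; omega
  | succ n ih =>
    obtain ⟨W, c, p, hW, hVW, -⟩ := hV.exists_edgeSum_unfold
    obtain ⟨U, c', p', hU, hWU, -⟩ := hW.exists_edgeSum_unfold
    have hi := (hVW i).bounds
    have hj := (hVW j).bounds
    have hi' := (hWU ((i - c) / 2)).bounds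
    have hj' := (hWU ((j - c) / 2)).bounds
    rw [pow_succ] at h1 h2
    have := ih hU (i := ((i - c) / 2 - c') / 2) (j := ((j - c) / 2 - c') / 2) (by omega) (by omega)
    rw [pow_succ]
    simp only [abs_le, mulOneAddI, Prod.fst_sub, Prod.snd_sub] at *
    omega

lemma IsCFCurve.edgeSum_injective {V : ℤ → ℤ × ℤ} (hV : IsCFCurve V) :
    Function.Injective (edgeSum V) := by
  suffices H : ∀ (d : ℕ) (V : ℤ → ℤ × ℤ), IsCFCurve V → ∀ i : ℤ,
      edgeSum V i ≠ edgeSum V (i + (d + 1)) by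
    intro i j hij
    rcases lt_trichotomy i j with h | h | h
    · refine absurd hij ?_
      have := H (j - i - 1).toNat V hV i
      rwa [show i + (((j - i - 1).toNat : ℤ) + 1) = j by omega] at this
    · exact h
    · refine absurd hij.symm ?_
      have := H (i - j - 1).toNat V hV j
      rwa [show j + (((i - j - 1).toNat : ℤ) + 1) = i by omega] at this
  intro d
  induction d using Nat.strong_induction_on with
  | _ d ih =>
    intro V hV i h
    rcases Nat.eq_zero_or_pos d with rfl | hd
    · obtain ⟨hu, η, ⟨hpm, -⟩, hturn⟩ := hV
      have u := hu i
      have t := hturn i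
      rw [rot_eq _ (hpm _)] at t
      simp only [edgeSum, CharP.cast_eq_zero, zero_add, add_assoc, Int.reduceAdd] at h
      simp only [IsUnitVec, Prod.ext_iff, Prod.fst_add, Prod.snd_add, Prod.fst_sub,
        Prod.snd_sub] at *
      rcases hpm i with h' | h' <;> rw [h'] at t <;> omega
    · obtain ⟨W, c, p, hW, -, hVW⟩ := hV.exists_edgeSum_unfold
      have hW' := hVW _ _ h
      obtain ⟨e, he⟩ : ∃ e : ℕ, (i + (d + 1) - c) / 2 = (i - c) / 2 + (e + 1) :=
        ⟨((i + (d + 1) - c) / 2 - (i - c) / 2 - 1).toNat, by omega⟩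
      rw [he] at hW'
      exact ih e (by omega) W hW _ hW'

lemma edge_eq_of_edgeSum_eq {V W : ℤ → ℤ × ℤ} {i j : ℤ} (hV : IsUnitVec (V (i + 1) - V i))
    (hW : IsUnitVec (W (j + 1) - W j)) (h : edgeSum V i = edgeSum W j) :
    s(V i, V (i + 1)) = s(W j, W (j + 1)) := by
  rw [Sym2.eq_iff]
  simp only [edgeSum, IsUnitVec, Prod.ext_iff, Prod.fst_add, Prod.snd_add, Prod.fst_sub,
    Prod.snd_sub] at *
  omega

lemma card_mul_le_of_edge_disjoint {r : ℕ} {C : Fin r → ℤ → ℤ × ℤ} (hC : ∀ m, IsCFCurve (C m))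
    (hdisj : ∀ m m', m ≠ m' → CurvesDisjoint (C m) (C m')) {M : ℕ}
    (hM : ∀ m, |(edgeSum (C m) 0).1| ≤ M ∧ |(edgeSum (C m) 0).2| ≤ M) (n : ℕ) :
    r * (4 * 4 ^ n) ≤ (4 * M + 12 * 2 ^ n + 1) * (2 * M + 6 * 2 ^ n + 1) := by
  set N : ℕ := 4 ^ n with hN
  set x : ℕ := 2 ^ n with hx
  let f : Fin r × ℤ → ℤ × ℤ := fun a => ((edgeSum (C a.1) a.2).1, (edgeSum (C a.1) a.2).2 / 2)
  have hcard := Finset.card_le_card_of_injOn f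
    (s := Finset.univ ×ˢ Finset.Ico (-(2 * N : ℤ)) (2 * N))
    (t := Finset.Icc (-(2 * M + 6 * x : ℤ)) (2 * M + 6 * x) ×ˢ
      Finset.Icc (-(M + 3 * x : ℤ)) (M + 3 * x)) ?_ ?_
  · simp only [Finset.card_product, Finset.card_univ, Fintype.card_fin, Int.card_Ico,
      Int.card_Icc] at hcard
    convert hcard using 2 <;> omega
  · rintro ⟨m, i⟩ hi
    simp only [Finset.coe_product, Finset.coe_univ, Finset.coe_Ico, Set.mem_prod, Set.mem_univ,
      Set.mem_Ico, true_and] at hi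
    have hb := (hC m).abs_edgeSum_sub_le n (i := i) (j := 0)
      (by push_cast [hN] at hi; omega) (by push_cast [hN] at hi; omega)
    have hm := hM m
    have hx' : (2 : ℤ) ^ n = x := by simp [hx]
    rw [hx'] at hb
    simp only [abs_le] at hb hm
    simp only [f, Finset.coe_product, Finset.coe_Icc, Set.mem_prod, Set.mem_Icc]
    omega
  · rintro ⟨m, i⟩ - ⟨m', j⟩ - h
    have hsum : edgeSum (C m) i = edgeSum (C m') j := by
      have h1 := (hC m).1 i
      have h2 := (hC m').1 j
      simp only [f, edgeSum, IsUnitVec, Prod.ext_iff, Prod.fst_add, Prod.snd_add, Prod.fst_sub,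
        Prod.snd_sub] at *
      omega
    obtain rfl : m = m' := by
      by_contra hne
      exact (hdisj m m' hne).1 i j (edge_eq_of_edgeSum_eq ((hC m).1 i) ((hC m').1 j) hsum)
    rw [(hC m).edgeSum_injective hsum]

theorem statement19 (r : ℕ) (C : Fin r → ℤ → ℤ × ℤ)
    (hC : ∀ m, IsCFCurve (C m))
    (hdisj : ∀ m m', m ≠ m' → CurvesDisjoint (C m) (C m')) : r ≤ 24 := by
  obtain ⟨M, hM⟩ : ∃ M : ℕ, ∀ m, |(edgeSum (C m) 0).1| ≤ M ∧ |(edgeSum (C m) 0).2| ≤ M := by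
    refine ⟨∑ m, ((edgeSum (C m) 0).1.natAbs + (edgeSum (C m) 0).2.natAbs), fun m => ?_⟩
    have := Finset.single_le_sum (f := fun m => (edgeSum (C m) 0).1.natAbs +
      (edgeSum (C m) 0).2.natAbs) (fun _ _ => Nat.zero_le _) (Finset.mem_univ m)
    rw [Int.abs_eq_natAbs, Int.abs_eq_natAbs]
    omega
  have h := card_mul_le_of_edge_disjoint hC hdisj hM (2 * M + 1)
  have hx : 2 * M + 1 < 2 ^ (2 * M + 1) := Nat.lt_two_pow_self
  rw [show (4 : ℕ) = 2 ^ 2 by norm_num, ← pow_mul, mul_comm 2 (2 * M + 1), pow_mul] at h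
  generalize 2 ^ (2 * M + 1) = x at h hx
  by_contra! hr
  have h25 : 25 * (4 * x ^ 2) ≤ r * (2 ^ 2 * x ^ 2) := by
    gcongr
    · omega
    · norm_num
  nlinarith
end
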